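/- arXiv:1309.4419 — 4 statements merged into one kernel-verified Lean document; each statement's English description precedes it below -/
import Mathlib

section
/- Let S₀ and S₁ be n×n complex matrices such that S₀ is unitary (S₀·S₀† = I) and the first-order commutator condition S₀·S₁† + S₁·S₀† = S₁†·S₀ + S₀†·S₁ holds (equivalently, [S₀,S₁†] + [S₁,S₀†] = 0, i.e. the commutator [S(h), S(h)†] of S(h) = S₀ + h·S₁ vanishes to first order in h). Then for every natural number N, as h → 0, (S₀ + h·S₁)^N · ((S₀ + h·S₁)^N)† = I + N·h·(S₀·S₁† + S₁·S₀†) + O(h²); that is, the function h ↦ (S₀ + h·S₁)^N·((S₀ + h·S₁)^N)† − I − N·h·(S₀·S₁† + S₁·S₀†) is O(h²) at h = 0. -/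
open Asymptotics

attribute [local instance] Matrix.normedAddCommGroup

open Matrix in
/-- The quadratic remainder of `S(h)^N·(S(h)^N)†` is `h²` times a continuous function. -/
theorem exists_continuous_remainder {n : ℕ} {S₀ S₁ A : Matrix (Fin n) (Fin n) ℂ}
    (hU : S₀ * S₀ᴴ = 1) (hA : S₀ * S₁ᴴ + S₁ * S₀ᴴ = A) (hconj : S₀ * A * S₀ᴴ = A) (N : ℕ) :
    ∃ R : ℝ → Matrix (Fin n) (Fin n) ℂ, Continuous R ∧ ∀ h : ℝ,
      (S₀ + (h : ℂ) • S₁) ^ N * ((S₀ + (h : ℂ) • S₁) ^ N)ᴴ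
        = 1 + ((N : ℂ) * (h : ℂ)) • A + ((h : ℂ) ^ 2) • R h := by
  induction N with
  | zero => exact ⟨fun _ => 0, continuous_const, fun h => by simp⟩
  | succ N ih =>
    obtain ⟨R, hR, hRe⟩ := ih
    refine ⟨fun h => (S₀ + (h : ℂ) • S₁) * R h * (S₀ᴴ + (h : ℂ) • S₁ᴴ) + S₁ * S₁ᴴ
      + (N : ℂ) • (S₀ * A * S₁ᴴ + S₁ * A * S₀ᴴ) + ((N : ℂ) * (h : ℂ)) • (S₁ * A * S₁ᴴ),
      by fun_prop, fun h => ?_⟩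
    have hS : (S₀ + (h : ℂ) • S₁)ᴴ = S₀ᴴ + (h : ℂ) • S₁ᴴ := by
      simp [conjTranspose_add, conjTranspose_smul]
    have hexp : (S₀ + (h : ℂ) • S₁) * (S₀ᴴ + (h : ℂ) • S₁ᴴ)
        = 1 + (h : ℂ) • A + ((h : ℂ) ^ 2) • (S₁ * S₁ᴴ) := by
      rw [← hU, ← hA]
      simp only [add_mul, mul_add, smul_mul_assoc, mul_smul_comm]
      module
    have hexpA : (S₀ + (h : ℂ) • S₁) * A * (S₀ᴴ + (h : ℂ) • S₁ᴴ)
        = A + (h : ℂ) • (S₀ * A * S₁ᴴ + S₁ * A * S₀ᴴ)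
          + ((h : ℂ) ^ 2) • (S₁ * A * S₁ᴴ) := by
      simp only [add_mul, mul_add, smul_mul_assoc, mul_smul_comm, hconj]
      module
    calc (S₀ + (h : ℂ) • S₁) ^ (N + 1) * ((S₀ + (h : ℂ) • S₁) ^ (N + 1))ᴴ
        = (S₀ + (h : ℂ) • S₁) * ((S₀ + (h : ℂ) • S₁) ^ N * ((S₀ + (h : ℂ) • S₁) ^ N)ᴴ)
            * (S₀ᴴ + (h : ℂ) • S₁ᴴ) := by
          rw [pow_succ', conjTranspose_mul, hS]
          simp only [mul_assoc]
      _ = (S₀ + (h : ℂ) • S₁) * (S₀ᴴ + (h : ℂ) • S₁ᴴ)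
            + ((N : ℂ) * (h : ℂ)) • ((S₀ + (h : ℂ) • S₁) * A * (S₀ᴴ + (h : ℂ) • S₁ᴴ))
            + ((h : ℂ) ^ 2) • ((S₀ + (h : ℂ) • S₁) * R h * (S₀ᴴ + (h : ℂ) • S₁ᴴ)) := by
          rw [hRe]
          generalize S₀ + (h : ℂ) • S₁ = S, S₀ᴴ + (h : ℂ) • S₁ᴴ = T
          rw [mul_add, mul_add, add_mul, add_mul, mul_one, mul_smul_comm, mul_smul_comm,
            smul_mul_assoc, smul_mul_assoc]
      _ = _ := by
          rw [hexp, hexpA]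
          push_cast
          module

/-- If `S₀` is unitary and the commutator `[S(h), S(h)†]` of `S(h) = S₀ + h·S₁` vanishes
to first order in `h` (the resonance condition), then for every number `N` of repetitions
`S(h)^N·(S(h)^N)† = I + N·h·(S₀·S₁† + S₁·S₀†) + O(h²)` as `h → 0`. -/
theorem statement9 (n : ℕ) (S₀ S₁ : Matrix (Fin n) (Fin n) ℂ)
    (hU : S₀ * S₀.conjTranspose = 1)
    (hres : S₀ * S₁.conjTranspose + S₁ * S₀.conjTranspose
        = S₁.conjTranspose * S₀ + S₀.conjTranspose * S₁) :
    ∀ N : ℕ,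
      (fun h : ℝ =>
          (S₀ + (h : ℂ) • S₁) ^ N * ((S₀ + (h : ℂ) • S₁) ^ N).conjTranspose - 1
            - ((N : ℂ) * (h : ℂ)) • (S₀ * S₁.conjTranspose + S₁ * S₀.conjTranspose))
        =O[nhds (0 : ℝ)] fun h : ℝ => h ^ 2 := by
  intro N
  have hconj : S₀ * (S₀ * S₁.conjTranspose + S₁ * S₀.conjTranspose) * S₀.conjTranspose
      = S₀ * S₁.conjTranspose + S₁ * S₀.conjTranspose := by
    conv_lhs => rw [hres]
    rw [mul_add, add_mul, ← mul_assoc S₀ S₀.conjTranspose, hU, one_mul, mul_assoc, mul_assoc,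
      hU, mul_one]
  obtain ⟨R, hR, hRe⟩ := exists_continuous_remainder hU rfl hconj N
  have hf : ∀ h : ℝ, (S₀ + (h : ℂ) • S₁) ^ N * ((S₀ + (h : ℂ) • S₁) ^ N).conjTranspose - 1
      - ((N : ℂ) * (h : ℂ)) • (S₀ * S₁.conjTranspose + S₁ * S₀.conjTranspose)
      = (h ^ 2) • R h := by
    intro h
    have hsmul : ((h : ℂ) ^ 2) • R h = (h ^ 2) • R h := by
      ext i j
      simp
    rw [hRe, ← hsmul]
    abel
  simp only [hf]
  obtain ⟨C, hC⟩ := (hR.tendsto 0).isBigO_one ℝ |>.bound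
  refine IsBigO.of_bound C ?_
  filter_upwards [hC] with h hh
  have hnorm : ‖(h ^ 2) • R h‖ = ‖h ^ 2‖ * ‖R h‖ := by
    let _ : NormedSpace ℝ (Matrix (Fin n) (Fin n) ℂ) := Matrix.normedSpace
    exact norm_smul _ _
  rw [hnorm, mul_comm]
  gcongr
  simpa using hh
end

section
/- Let r, φ ∈ ℝ. Define the 2×2 real matrices A = B = cosh(2r)·I₂, C = sinh(2r)·[[−cos φ, sin φ],[sin φ, cos φ]], σ₃ = [[1,0],[0,−1]], and N = σ₃·A·σ₃ + σ₃·C + Cᵀ·σ₃ + B. Then 2/√(4 + 2·tr(N) + det(N)) = 1/(1 + cosh(2r) − cos(φ)·sinh(2r)); i.e. the zeroth-order fidelity of continuous-variable teleportation using the freely evolved two-mode squeezed resource state is F̃⁽⁰⁾ = (1 + cosh(2r) − cos(φ)·sinh(2r))⁻¹. -/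
/-- `cosh x` dominates `cos φ * sinh x`. -/
theorem cos_mul_sinh_lt_cosh (φ x : ℝ) : Real.cos φ * Real.sinh x < Real.cosh x := by
  calc Real.cos φ * Real.sinh x ≤ |Real.cos φ| * |Real.sinh x| :=
        (le_abs_self _).trans_eq (abs_mul _ _)
    _ ≤ |Real.sinh x| := mul_le_of_le_one_left (abs_nonneg _) (Real.abs_cos_le_one φ)
    _ < Real.cosh x := abs_lt_of_sq_lt_sq' (by linarith [Real.cosh_sq x]) (Real.cosh_pos x).le
        |> abs_lt.mpr

/-- The zeroth-order fidelity of continuous-variable teleportation with the freely evolved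
two-mode squeezed resource state: with `A = B = cosh(2r)·I₂`,
`C = sinh(2r)·[[−cos φ, sin φ],[sin φ, cos φ]]` and
`N = σ₃·A·σ₃ + σ₃·C + Cᵀ·σ₃ + B`, one has
`2/√(4 + 2·tr N + det N) = 1/(1 + cosh(2r) − cos(φ)·sinh(2r))`. -/
theorem statement12 (r φ : ℝ) :
    let A : Matrix (Fin 2) (Fin 2) ℝ := Real.cosh (2 * r) • (1 : Matrix (Fin 2) (Fin 2) ℝ)
    let B : Matrix (Fin 2) (Fin 2) ℝ := Real.cosh (2 * r) • (1 : Matrix (Fin 2) (Fin 2) ℝ)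
    let C : Matrix (Fin 2) (Fin 2) ℝ :=
      Real.sinh (2 * r) • !![-Real.cos φ, Real.sin φ; Real.sin φ, Real.cos φ]
    let σ₃ : Matrix (Fin 2) (Fin 2) ℝ := !![1, 0; 0, -1]
    let Nm : Matrix (Fin 2) (Fin 2) ℝ := σ₃ * A * σ₃ + σ₃ * C + C.transpose * σ₃ + B
    2 / Real.sqrt (4 + 2 * Nm.trace + Nm.det) =
      1 / (1 + Real.cosh (2 * r) - Real.cos φ * Real.sinh (2 * r)) := by
  intro A B C σ₃ Nm
  have hN : Nm = (2 * (Real.cosh (2 * r) - Real.cos φ * Real.sinh (2 * r))) •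
      (1 : Matrix (Fin 2) (Fin 2) ℝ) := by
    ext i j
    fin_cases i <;> fin_cases j <;>
      simp [Nm, A, B, C, σ₃, Matrix.mul_apply, Fin.sum_univ_two] <;> ring
  have hpos := cos_mul_sinh_lt_cosh φ (2 * r)
  have hsq : 4 + 2 * Nm.trace + Nm.det =
      (2 * (1 + Real.cosh (2 * r) - Real.cos φ * Real.sinh (2 * r))) ^ 2 := by
    rw [hN]
    simp
    ring
  rw [hsq, Real.sqrt_sq (by linarith), div_mul_eq_div_div, div_self two_ne_zero]
end

section
/- For all m, n ∈ ℤ and s ∈ [0,1), the Bogoliubov coefficient A_{mn}(h) tends, as h → 0 from the right, to δ_{mn}, i.e. to 1 if m = n and to 0 if m ≠ n. -/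
/-- The massless Dirac cavity Bogoliubov coefficient `A_{mn}(h)`: the conserved inner product
between the `n`-th Minkowski mode and the `m`-th Rindler mode, written in dimensionless
coordinates on the `t = 0` hypersurface, with `L(h) = log((2+h)/(2−h))` and
`Λ(Z,h) = log((Z + 1/h)/(1/h − 1/2))/L(h)`. -/
noncomputable def diracBogoA (s : ℝ) (m n : ℤ) (h : ℝ) : ℝ :=
  ∫ Z in (-(1 : ℝ)/2)..(1/2),
    (Real.sqrt ((Z + 1/h) * Real.log ((2 + h) / (2 - h))))⁻¹ *
      Real.cos (((m : ℝ) + s) * Real.pi *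
          (Real.log ((Z + 1/h) / (1/h - 1/2)) / Real.log ((2 + h) / (2 - h))) -
        ((n : ℝ) + s) * Real.pi * (Z + 1/2))

/-- The first-order expansion `log ((1 + h Z) / (1 - h / 2)) ∼ (Z + 1/2) h` as `h → 0⁺`. -/
lemma tendsto_log_ratio_div (Z : ℝ) :
    Filter.Tendsto (fun h : ℝ => Real.log ((1 + h * Z) / (1 - h / 2)) / h)
      (nhdsWithin 0 (Set.Ioi 0)) (nhds (Z + 1 / 2)) := by
  have hnum : HasDerivAt (fun h : ℝ => 1 + h * Z) Z 0 := by
    simpa using ((hasDerivAt_id (0 : ℝ)).mul_const Z).const_add 1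
  have hden : HasDerivAt (fun h : ℝ => 1 - h / 2) (-(1 / 2)) 0 := by
    simpa using ((hasDerivAt_id (0 : ℝ)).div_const 2).const_sub 1
  have hlog := (hnum.fun_div hden (by norm_num)).log (by norm_num)
  have hslope := hlog.tendsto_slope_zero_right
  refine hslope.congr (fun h => ?_) |>.trans_eq ?_
  · simp [div_eq_inv_mul]
  · norm_num

/-- Near `h = 0⁺`, the logarithm `L(h)` is comparable to `h`. -/
lemma tendsto_log_length_div :
    Filter.Tendsto (fun h : ℝ => Real.log ((2 + h) / (2 - h)) / h)
      (nhdsWithin 0 (Set.Ioi 0)) (nhds 1) := by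
  have key := tendsto_log_ratio_div (1 / 2)
  norm_num at key
  refine key.congr fun h => ?_
  congr 2
  rw [← mul_div_mul_left (1 + h * (1 / 2)) (1 - h / 2) (two_ne_zero' ℝ)]
  ring_nf

/-- The squared normalisation `(Z + 1/h) L(h)` of the Rindler modes tends to `1`. -/
lemma tendsto_rindler_normalisation (Z : ℝ) :
    Filter.Tendsto (fun h : ℝ => (Z + 1 / h) * Real.log ((2 + h) / (2 - h)))
      (nhdsWithin 0 (Set.Ioi 0)) (nhds 1) := by
  have hlin : Filter.Tendsto (fun h : ℝ => 1 + h * Z) (nhdsWithin 0 (Set.Ioi 0)) (nhds 1) := by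
    have hcont : Continuous fun h : ℝ => 1 + h * Z := by fun_prop
    simpa using (hcont.tendsto 0).mono_left nhdsWithin_le_nhds
  have key := hlin.mul tendsto_log_length_div
  rw [one_mul] at key
  refine key.congr' ?_
  filter_upwards [self_mem_nhdsWithin] with h hh
  have hh : h ≠ 0 := ne_of_gt hh
  field_simp
  ring

/-- The Rindler phase `Λ(Z, h)` tends to the Minkowski phase `Z + 1/2`. -/
lemma tendsto_rindler_phase (Z : ℝ) :
    Filter.Tendsto
      (fun h : ℝ => Real.log ((Z + 1 / h) / (1 / h - 1 / 2)) / Real.log ((2 + h) / (2 - h)))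
      (nhdsWithin 0 (Set.Ioi 0)) (nhds (Z + 1 / 2)) := by
  have key := (tendsto_log_ratio_div Z).div tendsto_log_length_div one_ne_zero
  rw [div_one] at key
  refine key.congr' ?_
  filter_upwards [self_mem_nhdsWithin] with h hh
  have hh : h ≠ 0 := ne_of_gt hh
  have hratio : (1 + h * Z) / (1 - h / 2) = (Z + 1 / h) / (1 / h - 1 / 2) := by
    rw [← mul_div_mul_left (Z + 1 / h) (1 / h - 1 / 2) hh]
    congr 1 <;> field_simp
    ring
  rw [Pi.div_apply, div_div_div_cancel_right₀ hh, hratio]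

/-- Orthonormality of the cosines `cos (k π (Z + 1/2))` to the constant on the unit interval. -/
lemma integral_cos_int_mul_pi (k : ℤ) :
    ∫ Z in (-(1 : ℝ) / 2)..(1 / 2), Real.cos ((k : ℝ) * Real.pi * (Z + 1 / 2)) =
      if k = 0 then 1 else 0 := by
  split_ifs with hk
  · subst hk
    norm_num
  · have hc : (k : ℝ) * Real.pi ≠ 0 := mul_ne_zero (by exact_mod_cast hk) Real.pi_ne_zero
    simp only [mul_add]
    rw [intervalIntegral.integral_comp_mul_add (fun x => Real.cos x) hc, integral_cos]
    have h1 : (k : ℝ) * Real.pi * (1 / 2) + k * Real.pi * (1 / 2) = k * Real.pi := by ring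
    have h2 : (k : ℝ) * Real.pi * (-1 / 2) + k * Real.pi * (1 / 2) = 0 := by ring
    rw [h1, h2, Real.sin_int_mul_pi]
    simp

/-- As `h → 0⁺`, the Bogoliubov coefficient `A_{mn}(h)` tends to `δ_{mn}`. -/
theorem statement16 (m n : ℤ) (s : ℝ) (hs0 : 0 ≤ s) (hs1 : s < 1) :
    Filter.Tendsto (fun h : ℝ => diracBogoA s m n h) (nhdsWithin 0 (Set.Ioi 0))
      (nhds (if m = n then (1 : ℝ) else 0)) := by
  have hlim : (if m = n then (1 : ℝ) else 0) =
      ∫ Z in (-(1 : ℝ) / 2)..(1 / 2), Real.cos (((m - n : ℤ) : ℝ) * Real.pi * (Z + 1 / 2)) := by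
    simp only [integral_cos_int_mul_pi, sub_eq_zero]
  rw [hlim]
  unfold diracBogoA
  refine intervalIntegral.tendsto_integral_filter_of_dominated_convergence (fun _ => 2)
    (Filter.Eventually.of_forall fun h => ?_) ?_ intervalIntegrable_const
    (Filter.Eventually.of_forall fun Z _ => ?_)
  · exact Measurable.aestronglyMeasurable (by fun_prop)
  · have hL : ∀ᶠ h : ℝ in nhdsWithin 0 (Set.Ioi 0),
        1 / 2 < Real.log ((2 + h) / (2 - h)) / h :=
      tendsto_log_length_div.eventually_const_lt (by norm_num)
    filter_upwards [hL, Ioo_mem_nhdsGT (zero_lt_one' ℝ)] with h hL hh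
    refine Filter.Eventually.of_forall fun Z hZ => ?_
    rw [Set.uIoc_of_le (by norm_num)] at hZ
    have hlin : 1 / 2 ≤ 1 + h * Z := by nlinarith [hZ.1, hh.1, hh.2]
    have hfactor : (Z + 1 / h) * Real.log ((2 + h) / (2 - h)) =
        (1 + h * Z) * (Real.log ((2 + h) / (2 - h)) / h) := by
      have := hh.1.ne'
      field_simp
      ring
    have hquarter : (1 / 2 : ℝ) ≤ √((Z + 1 / h) * Real.log ((2 + h) / (2 - h))) := by
      refine Real.le_sqrt_of_sq_le ?_
      rw [hfactor]
      nlinarith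
    rw [norm_mul, norm_inv, Real.norm_of_nonneg (Real.sqrt_nonneg _)]
    calc _ ≤ (1 / 2 : ℝ)⁻¹ * 1 := by
          gcongr
          exact Real.abs_cos_le_one _
      _ = 2 := by norm_num
  · have hnorm := ((tendsto_rindler_normalisation Z).sqrt.inv₀ (by norm_num))
    have hphase := (((tendsto_rindler_phase Z).const_mul (((m : ℝ) + s) * Real.pi)).sub_const
      (((n : ℝ) + s) * Real.pi * (Z + 1 / 2)))
    have hprod := hnorm.mul ((Real.continuous_cos.tendsto _).comp hphase)
    refine hprod.trans_eq ?_
    rw [Real.sqrt_one, inv_one, one_mul]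
    congr 2
    push_cast
    ring
end

section
/- For all m, n ∈ ℤ with m ≠ n and s ∈ [0,1), the ratio A_{mn}(h)/h tends, as h → 0 from the right, to ((−1)^{m+n} − 1)·(m + n + 2s)/(2π²·(m − n)³); that is, the first-order Maclaurin coefficient of the Minkowski-to-Rindler Bogoliubov transformation of the massless Dirac cavity field is A^{(1)}_{mn} = ((−1)^{m+n} − 1)(m + n + 2s)/(2π²(m−n)³) for m ≠ n. -/
theorem abs_log_one_add_sub_le {x h : ℝ} (hh : h ≤ 1 / 2) (hx : |x| ≤ h / 2) :
    |Real.log (1 + x) - (x - x ^ 2 / 2)| ≤ h ^ 3 / 6 := by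
  have hx0 := abs_nonneg x
  have key := Real.abs_log_sub_add_sum_range_le (x := -x) (by rw [abs_neg]; linarith) 2
  simp only [Finset.sum_range_succ, Finset.sum_range_zero, abs_neg, sub_neg_eq_add] at key
  have hcube : |x| ^ 3 ≤ (h / 2) ^ 3 := pow_le_pow_left₀ hx0 hx 3
  have hbound : |x| ^ (2 + 1) / (1 - |x|) ≤ h ^ 3 / 6 := by
    rw [div_le_iff₀ (by linarith)]
    have : 0 ≤ h ^ 3 := pow_nonneg (by linarith) 3
    norm_num
    nlinarith
  refine le_trans (le_of_eq ?_) (key.trans hbound)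
  congr 1
  push_cast
  ring

theorem abs_inv_sqrt_sub_le {w : ℝ} (hw : 1 / 2 ≤ w) :
    |(Real.sqrt w)⁻¹ - 1 + (w - 1) / 2| ≤ 2 * (w - 1) ^ 2 := by
  have hb2 : Real.sqrt w ^ 2 = w := Real.sq_sqrt (by linarith)
  have hb : 2 / 3 ≤ Real.sqrt w := Real.le_sqrt_of_sq_le (by linarith)
  generalize Real.sqrt w = b at hb2 hb
  subst hb2
  have hb0 : 0 < b := by linarith
  have e : b⁻¹ - 1 + (b ^ 2 - 1) / 2 = (b - 1) ^ 2 * ((b + 2) / (2 * b)) := by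
    field_simp
    ring
  have h1 : (b + 2) / (2 * b) ≤ 2 := by
    rw [div_le_iff₀ (by linarith)]
    linarith
  have h2 : (b - 1) ^ 2 ≤ (b ^ 2 - 1) ^ 2 := by
    have : (b ^ 2 - 1) ^ 2 = (b - 1) ^ 2 * (b + 1) ^ 2 := by ring
    rw [this]
    exact le_mul_of_one_le_right (sq_nonneg _) (by nlinarith)
  rw [e, abs_of_nonneg (by positivity)]
  calc (b - 1) ^ 2 * ((b + 2) / (2 * b)) ≤ (b ^ 2 - 1) ^ 2 * 2 := by gcongr
    _ = _ := by ring

theorem abs_cos_add_sub_le (θ δ : ℝ) :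
    |Real.cos (θ + δ) - Real.cos θ + δ * Real.sin θ| ≤ 2 * δ ^ 2 := by
  have h1 : |Real.cos δ - 1| ≤ δ ^ 2 / 2 := by
    rw [abs_le]
    constructor <;> nlinarith [Real.one_sub_sq_div_two_le_cos (x := δ), Real.cos_le_one δ]
  have h2 : |Real.sin δ - δ| ≤ δ ^ 2 := by
    have hd0 := abs_nonneg δ
    rw [← sq_abs δ, abs_sub_comm]
    rcases le_or_gt |δ| 2 with hd | hd
    · refine (Real.abs_sub_sin_le δ).trans ?_
      nlinarith [mul_nonneg (sq_nonneg |δ|) (sub_nonneg.2 hd)]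
    · have h3 : |δ - Real.sin δ| ≤ |δ| + |Real.sin δ| := abs_sub _ _
      have h4 := Real.abs_sin_le_one δ
      nlinarith
  have e : Real.cos (θ + δ) - Real.cos θ + δ * Real.sin θ =
      Real.cos θ * (Real.cos δ - 1) - Real.sin θ * (Real.sin δ - δ) := by
    rw [Real.cos_add]
    ring
  rw [e]
  calc _ ≤ |Real.cos θ * (Real.cos δ - 1)| + |Real.sin θ * (Real.sin δ - δ)| := abs_sub _ _
    _ ≤ 1 * (δ ^ 2 / 2) + 1 * δ ^ 2 := by
      rw [abs_mul, abs_mul]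
      gcongr
      · exact Real.abs_cos_le_one θ
      · exact Real.abs_sin_le_one θ
    _ ≤ _ := by nlinarith [sq_nonneg δ]

theorem abs_log_ratio_sub_le {h : ℝ} (h0 : 0 < h) (hh : h ≤ 1 / 2) :
    |Real.log ((2 + h) / (2 - h)) - h| ≤ h ^ 3 / 3 := by
  have e : Real.log ((2 + h) / (2 - h)) = Real.log (1 + h / 2) - Real.log (1 + -(h / 2)) := by
    rw [← Real.log_div (by linarith) (by linarith)]
    congr 1
    have h2 : 2 - h ≠ 0 := by linarith
    have h3 : 1 + -(h / 2) ≠ 0 := by linarith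
    rw [div_eq_div_iff h2 h3]
    ring
  have h1 := abs_log_one_add_sub_le (x := h / 2) hh (by rw [abs_of_pos (by linarith)])
  have h2 := abs_log_one_add_sub_le (x := -(h / 2)) hh (by rw [abs_neg, abs_of_pos (by linarith)])
  rw [e]
  rw [abs_le] at *
  constructor <;> nlinarith

theorem half_le_log_ratio {h : ℝ} (h0 : 0 < h) (hh : h ≤ 1 / 2) :
    h / 2 ≤ Real.log ((2 + h) / (2 - h)) := by
  have := (abs_le.1 (abs_log_ratio_sub_le h0 hh)).1
  nlinarith [mul_nonneg h0.le (mul_nonneg h0.le (sub_nonneg.2 hh)), mul_nonneg h0.le (sub_nonneg.2 hh)]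

theorem abs_rindler_coord_sub_le {h Z : ℝ} (h0 : 0 < h) (hh : h ≤ 1 / 2) (hZ : |Z| ≤ 1 / 2) :
    |Real.log ((Z + 1/h) / (1/h - 1/2)) / Real.log ((2 + h) / (2 - h)) -
      (Z + 1 / 2 + h * (1 / 8 - Z ^ 2 / 2))| ≤ 2 * h ^ 2 := by
  have hZ' := abs_le.1 hZ
  have hZh : |Z * h| ≤ h / 2 := by
    rw [abs_mul, abs_of_pos h0]
    nlinarith
  have e : Real.log ((Z + 1/h) / (1/h - 1/2)) =
      Real.log (1 + Z * h) - Real.log (1 + -(h / 2)) := by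
    have := abs_le.1 hZh
    have h3 : 1 + -(h / 2) ≠ 0 := by linarith
    rw [← Real.log_div (by linarith) h3]
    congr 1
    have : 1 / h - 1 / 2 = (1 + -(h / 2)) / h := by
      field_simp
      ring
    rw [this]
    field_simp
    ring
  have h1 := abs_log_one_add_sub_le hh hZh
  have h2 := abs_log_one_add_sub_le (x := -(h / 2)) hh (by rw [abs_neg, abs_of_pos (by linarith)])
  have h3 := abs_log_ratio_sub_le h0 hh
  have h4 := half_le_log_ratio h0 hh
  rw [e]
  generalize Real.log ((2 + h) / (2 - h)) = L at *
  generalize Real.log (1 + Z * h) = p at *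
  generalize Real.log (1 + -(h / 2)) = q at *
  have hL : 0 < L := by linarith
  set v := Z + 1 / 2 + h * (1 / 8 - Z ^ 2 / 2) with hv
  have hv1 : |v| ≤ 2 := by
    rw [abs_le]
    constructor <;> nlinarith
  have e2 : (p - q) / L - v = ((p - (Z * h - (Z * h) ^ 2 / 2)) -
      (q - (-(h / 2) - (-(h / 2)) ^ 2 / 2)) - v * (L - h)) / L := by
    rw [hv]
    field_simp
    ring
  rw [e2, abs_div, abs_of_pos hL, div_le_iff₀ hL]
  calc _ ≤ |p - (Z * h - (Z * h) ^ 2 / 2)| +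
      |q - (-(h / 2) - (-(h / 2)) ^ 2 / 2)| + |v| * |L - h| := by
        rw [← abs_mul]
        exact (abs_sub _ _).trans (by gcongr; exact abs_sub _ _)
    _ ≤ h ^ 3 / 6 + h ^ 3 / 6 + 2 * (h ^ 3 / 3) := by gcongr
    _ = 2 * h ^ 2 * (h / 2) := by ring
    _ ≤ _ := by gcongr

theorem weight_bounds {h Z : ℝ} (h0 : 0 < h) (hh : h ≤ 1 / 2) (hZ : |Z| ≤ 1 / 2) :
    1 / 2 ≤ (Z + 1/h) * Real.log ((2 + h) / (2 - h)) ∧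
      |(Z + 1/h) * Real.log ((2 + h) / (2 - h)) - 1 - Z * h| ≤ h ^ 2 / 2 := by
  have hZ' := abs_le.1 hZ
  have h3 := abs_log_ratio_sub_le h0 hh
  generalize Real.log ((2 + h) / (2 - h)) = L at *
  have e : (Z + 1/h) * L - 1 - Z * h = (1 + Z * h) * ((L - h) / h) := by
    field_simp
    ring
  have hZh : |Z * h| ≤ 1 / 4 := by
    rw [abs_mul, abs_of_pos h0]
    nlinarith [abs_nonneg Z]
  have h5 : |(L - h) / h| ≤ h ^ 2 / 3 := by
    rw [abs_div, abs_of_pos h0, div_le_iff₀ h0]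
    linarith
  have h6 : |1 + Z * h| ≤ 5 / 4 := by
    rw [abs_le] at *
    constructor <;> linarith
  have h7 : |(Z + 1/h) * L - 1 - Z * h| ≤ h ^ 2 / 2 := by
    rw [e, abs_mul]
    calc _ ≤ 5 / 4 * (h ^ 2 / 3) := by gcongr
      _ ≤ _ := by nlinarith [sq_nonneg h]
  refine ⟨?_, h7⟩
  have := (abs_le.1 h7).1
  have := (abs_le.1 hZh).1
  nlinarith

theorem abs_inv_sqrt_weight_sub_le {h Z : ℝ} (h0 : 0 < h) (hh : h ≤ 1 / 2) (hZ : |Z| ≤ 1 / 2) :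
    |(Real.sqrt ((Z + 1/h) * Real.log ((2 + h) / (2 - h))))⁻¹ - 1 + Z * h / 2| ≤ 3 * h ^ 2 := by
  obtain ⟨h1, h2⟩ := weight_bounds h0 hh hZ
  have h3 := abs_inv_sqrt_sub_le h1
  generalize (Z + 1/h) * Real.log ((2 + h) / (2 - h)) = w at *
  have hZh : |Z * h| ≤ h / 2 := by
    rw [abs_mul, abs_of_pos h0]
    nlinarith
  have h4 : (w - 1) ^ 2 ≤ h ^ 2 := by
    apply sq_le_sq'
    all_goals
      rw [abs_le] at h2 hZh
      nlinarith
  rw [abs_le] at *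
  constructor <;> linarith

/-- The zeroth-order part of the integrand of `diracBogoA`. -/
noncomputable def bogoIntegrandZero (c Z : ℝ) : ℝ := Real.cos (c * (Z + 1 / 2))

/-- The first-order part of the integrand of `diracBogoA`. -/
noncomputable def bogoIntegrandOne (c N Z : ℝ) : ℝ :=
  -(Z / 2) * Real.cos (c * (Z + 1 / 2)) -
    N * (1 / 8 - Z ^ 2 / 2) * Real.sin (c * (Z + 1 / 2))

theorem integral_bogoIntegrandZero (k : ℤ) (hk : k ≠ 0) :
    ∫ Z in (-(1 : ℝ)/2)..(1/2), bogoIntegrandZero (k * Real.pi) Z = 0 := by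
  have hc : (k : ℝ) * Real.pi ≠ 0 := mul_ne_zero (by exact_mod_cast hk) Real.pi_ne_zero
  have hs : Real.sin (k * Real.pi) = 0 := Real.sin_int_mul_pi k
  generalize (k : ℝ) * Real.pi = c at *
  rw [intervalIntegral.integral_eq_sub_of_hasDerivAt
    (f := fun Z => Real.sin (c * (Z + 1 / 2)) / c)]
  · norm_num [hs]
  · intro Z _
    have h1 : HasDerivAt (fun Z : ℝ => c * (Z + 1 / 2)) (c * 1) Z :=
      ((hasDerivAt_id Z).add_const _).const_mul c
    refine (h1.sin.div_const c).congr_deriv ?_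
    unfold bogoIntegrandZero
    field_simp
  · exact Continuous.intervalIntegrable (by unfold bogoIntegrandZero; fun_prop) _ _

theorem integral_bogoIntegrandOne (k : ℤ) (hk : k ≠ 0) (N : ℝ) :
    ∫ Z in (-(1 : ℝ)/2)..(1/2), bogoIntegrandOne (k * Real.pi) N Z =
      ((-1) ^ k - 1) * (N / (k * Real.pi) ^ 3 - 1 / (2 * (k * Real.pi) ^ 2)) := by
  have hc : (k : ℝ) * Real.pi ≠ 0 := mul_ne_zero (by exact_mod_cast hk) Real.pi_ne_zero
  have hs : Real.sin (k * Real.pi) = 0 := Real.sin_int_mul_pi k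
  have hcos : Real.cos (k * Real.pi) = (-1) ^ k := Real.cos_int_mul_pi k
  generalize (k : ℝ) * Real.pi = c at *
  rw [intervalIntegral.integral_eq_sub_of_hasDerivAt
    (f := fun Z => (N / c ^ 2 * Z - Z / (2 * c)) * Real.sin (c * (Z + 1 / 2)) +
      (N / c * (1 / 8 - Z ^ 2 / 2) + (N / c ^ 3 - 1 / (2 * c ^ 2))) *
        Real.cos (c * (Z + 1 / 2)))]
  · norm_num [hs, hcos]
    ring
  · intro Z _
    have h1 : HasDerivAt (fun Z : ℝ => c * (Z + 1 / 2)) (c * 1) Z :=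
      ((hasDerivAt_id Z).add_const _).const_mul c
    have h2 : HasDerivAt (fun Z : ℝ => N / c ^ 2 * Z - Z / (2 * c))
        (N / c ^ 2 * 1 - 1 / (2 * c)) Z :=
      ((hasDerivAt_id Z).const_mul _).sub ((hasDerivAt_id Z).div_const _)
    have h3 : HasDerivAt
        (fun Z : ℝ => N / c * (1 / 8 - Z ^ 2 / 2) + (N / c ^ 3 - 1 / (2 * c ^ 2)))
        (N / c * (-((2 : ℕ) * Z ^ (2 - 1) / 2))) Z :=
      ((((hasDerivAt_pow 2 Z).div_const 2).const_sub (1 / 8)).const_mul (N / c)).add_const _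
    refine ((h2.mul h1.sin).add (h3.mul h1.cos)).congr_deriv ?_
    unfold bogoIntegrandOne
    push_cast
    field_simp
    ring
  · exact Continuous.intervalIntegrable (by unfold bogoIntegrandOne; fun_prop) _ _

/-- The integrand of `diracBogoA` agrees with its first-order expansion, uniformly in `Z`. -/
theorem abs_bogoIntegrand_sub_le (M N' : ℝ) {h Z : ℝ} (h0 : 0 < h) (hh : h ≤ 1 / 2)
    (hZ : |Z| ≤ 1 / 2) :
    |(Real.sqrt ((Z + 1/h) * Real.log ((2 + h) / (2 - h))))⁻¹ *
      Real.cos (M * Real.pi *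
          (Real.log ((Z + 1/h) / (1/h - 1/2)) / Real.log ((2 + h) / (2 - h))) -
        N' * Real.pi * (Z + 1/2)) -
      (bogoIntegrandZero ((M - N') * Real.pi) Z +
        h * bogoIntegrandOne ((M - N') * Real.pi) (M * Real.pi) Z)| ≤
      (3 + 8 * (M * Real.pi) ^ 2 + 3 * |M * Real.pi|) * h ^ 2 := by
  have ha := abs_inv_sqrt_weight_sub_le h0 hh hZ
  have hr := abs_rindler_coord_sub_le h0 hh hZ
  have hZ' := abs_le.1 hZ
  generalize (Real.sqrt ((Z + 1/h) * Real.log ((2 + h) / (2 - h))))⁻¹ = a at *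
  generalize Real.log ((Z + 1/h) / (1/h - 1/2)) / Real.log ((2 + h) / (2 - h)) = l at *
  unfold bogoIntegrandZero bogoIntegrandOne
  set θ := (M - N') * Real.pi * (Z + 1 / 2) with hθ
  set K := M * Real.pi with hK
  set g := 1 / 8 - Z ^ 2 / 2 with hg
  have hδ1 : |l - (Z + 1 / 2)| ≤ 2 * h := by
    have hg0 : 0 ≤ g := by rw [hg]; nlinarith
    have hg1 : g ≤ 1 / 8 := by rw [hg]; nlinarith
    rw [abs_le] at hr ⊢
    constructor <;> nlinarith
  set δ := K * (l - (Z + 1 / 2)) with hδ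
  have e1 : K * l - N' * Real.pi * (Z + 1 / 2) = θ + δ := by
    rw [hθ, hδ, hK]
    ring
  rw [e1]
  have hδK : |δ| ≤ |K| * (2 * h) := by
    rw [hδ, abs_mul]
    gcongr
  have hδ2 : δ ^ 2 ≤ 4 * K ^ 2 * h ^ 2 := by
    rw [← sq_abs δ, ← sq_abs K]
    calc |δ| ^ 2 ≤ (|K| * (2 * h)) ^ 2 := by gcongr
      _ = _ := by ring
  have hc := abs_cos_add_sub_le θ δ
  have hlip : |Real.cos (θ + δ) - Real.cos θ| ≤ |δ| := by
    simpa using Real.abs_cos_sub_cos_le (θ + δ) θ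
  have e2 : a * Real.cos (θ + δ) - (Real.cos θ + h * (-(Z / 2) * Real.cos θ - K * g * Real.sin θ))
      = (a - 1 + Z * h / 2) * Real.cos (θ + δ) +
        (Real.cos (θ + δ) - Real.cos θ + δ * Real.sin θ) +
        -(K * (l - (Z + 1 / 2 + h * g)) * Real.sin θ) +
        -(Z * h / 2 * (Real.cos (θ + δ) - Real.cos θ)) := by
    rw [hδ]
    ring
  have t1 : |(a - 1 + Z * h / 2) * Real.cos (θ + δ)| ≤ 3 * h ^ 2 * 1 := by
    rw [abs_mul]
    gcongr
    exact Real.abs_cos_le_one _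
  have t3 : |-(K * (l - (Z + 1 / 2 + h * g)) * Real.sin θ)| ≤ |K| * (2 * h ^ 2) * 1 := by
    rw [abs_neg, abs_mul, abs_mul]
    gcongr
    exact Real.abs_sin_le_one _
  have t4 : |-(Z * h / 2 * (Real.cos (θ + δ) - Real.cos θ))| ≤ (1 / 2) * h / 2 * (|K| * (2 * h)) := by
    rw [abs_neg, abs_mul, abs_div, abs_mul, abs_of_pos h0, abs_two]
    gcongr
    exact hlip.trans hδK
  rw [e2]
  calc _ ≤ 3 * h ^ 2 * 1 + 2 * δ ^ 2 + |K| * (2 * h ^ 2) * 1 +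
        (1 / 2) * h / 2 * (|K| * (2 * h)) :=
      (abs_add_le _ _).trans (add_le_add ((abs_add_le _ _).trans
        (add_le_add ((abs_add_le _ _).trans (add_le_add t1 hc)) t3)) t4)
    _ ≤ _ := by nlinarith [mul_nonneg (abs_nonneg K) (sq_nonneg h)]

theorem intervalIntegrable_diracBogoA (M N' : ℝ) {h : ℝ} (h0 : 0 < h) (hh : h ≤ 1 / 2) :
    IntervalIntegrable (fun Z : ℝ =>
      (Real.sqrt ((Z + 1/h) * Real.log ((2 + h) / (2 - h))))⁻¹ *
      Real.cos (M * Real.pi *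
          (Real.log ((Z + 1/h) / (1/h - 1/2)) / Real.log ((2 + h) / (2 - h))) -
        N' * Real.pi * (Z + 1/2))) MeasureTheory.volume (-(1 : ℝ)/2) (1/2) := by
  apply ContinuousOn.intervalIntegrable
  rw [Set.uIcc_of_le (by norm_num)]
  have hinv : 2 ≤ 1 / h := by
    rw [le_div_iff₀ h0]
    linarith
  have hsqrt : ∀ Z ∈ Set.Icc (-(1 : ℝ)/2) (1/2),
      Real.sqrt ((Z + 1/h) * Real.log ((2 + h) / (2 - h))) ≠ 0 := fun Z hZ => by
    have hw := (weight_bounds (Z := Z) h0 hh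
      (abs_le.2 ⟨by linarith [hZ.1], hZ.2⟩)).1
    exact (Real.sqrt_pos.2 (by linarith)).ne'
  have hlog : ∀ Z ∈ Set.Icc (-(1 : ℝ)/2) (1/2), (Z + 1/h) / (1/h - 1/2) ≠ 0 := fun Z hZ =>
    div_ne_zero (by linarith [hZ.1]) (by linarith)
  refine ContinuousOn.mul (ContinuousOn.inv₀ (by fun_prop) hsqrt) ?_
  refine Real.continuous_cos.comp_continuousOn (ContinuousOn.sub (ContinuousOn.mul
    continuousOn_const (ContinuousOn.div_const (ContinuousOn.log (by fun_prop) hlog) _))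
    (by fun_prop))

theorem abs_diracBogoA_sub_le (m n : ℤ) (hmn : m ≠ n) (s : ℝ) {h : ℝ} (h0 : 0 < h)
    (hh : h ≤ 1 / 2) :
    |diracBogoA s m n h - h * ((((-1 : ℝ) ^ (m + n) - 1) * ((m : ℝ) + (n : ℝ) + 2 * s)) /
        (2 * Real.pi ^ 2 * ((m : ℝ) - (n : ℝ)) ^ 3))| ≤
      (3 + 8 * ((m + s) * Real.pi) ^ 2 + 3 * |(m + s) * Real.pi|) * h ^ 2 := by
  have hk : m - n ≠ 0 := sub_ne_zero.2 hmn
  have hkR : (m : ℝ) - n ≠ 0 := sub_ne_zero.2 (by exact_mod_cast hmn)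
  have i0 := integral_bogoIntegrandZero (m - n) hk
  have i1 := integral_bogoIntegrandOne (m - n) hk ((m + s) * Real.pi)
  have hpow : (-1 : ℝ) ^ (m - n) = (-1) ^ (m + n) := by
    have : m + n = (m - n) + 2 * n := by ring
    rw [this, zpow_add₀ (by norm_num), zpow_mul]
    norm_num
  have hcast : ((m - n : ℤ) : ℝ) = (m + s) - (n + s) := by
    push_cast
    ring
  rw [hcast] at i0 i1
  have c0 : IntervalIntegrable (bogoIntegrandZero (((m + s) - (n + s)) * Real.pi))
      MeasureTheory.volume (-(1 : ℝ)/2) (1/2) :=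
    Continuous.intervalIntegrable (by unfold bogoIntegrandZero; fun_prop) _ _
  have c1 : IntervalIntegrable (fun Z => h * bogoIntegrandOne (((m + s) - (n + s)) * Real.pi)
      ((m + s) * Real.pi) Z) MeasureTheory.volume (-(1 : ℝ)/2) (1/2) :=
    Continuous.intervalIntegrable (by unfold bogoIntegrandOne; fun_prop) _ _
  have e : h * ((((-1 : ℝ) ^ (m + n) - 1) * ((m : ℝ) + (n : ℝ) + 2 * s)) /
        (2 * Real.pi ^ 2 * ((m : ℝ) - (n : ℝ)) ^ 3)) =
      ∫ Z in (-(1 : ℝ)/2)..(1/2), (bogoIntegrandZero (((m + s) - (n + s)) * Real.pi) Z +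
        h * bogoIntegrandOne (((m + s) - (n + s)) * Real.pi) ((m + s) * Real.pi) Z) := by
    rw [intervalIntegral.integral_add c0 c1, intervalIntegral.integral_const_mul, i0, i1, hpow]
    have hsub : ((m : ℝ) + s) - (n + s) = m - n := by ring
    have hpi := Real.pi_ne_zero
    rw [hsub]
    field_simp
    ring
  rw [e, diracBogoA, ← intervalIntegral.integral_sub
    (intervalIntegrable_diracBogoA (m + s) (n + s) h0 hh) (c0.add c1), ← Real.norm_eq_abs]
  refine (intervalIntegral.norm_integral_le_of_norm_le_const fun Z hZ => ?_).trans_eq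
    (b := (3 + 8 * ((m + s) * Real.pi) ^ 2 + 3 * |(m + s) * Real.pi|) * h ^ 2 *
      |1 / 2 - (-(1 : ℝ) / 2)|) (by norm_num)
  rw [Set.uIoc_of_le (by norm_num)] at hZ
  exact abs_bogoIntegrand_sub_le _ _ h0 hh (abs_le.2 ⟨by linarith [hZ.1], hZ.2⟩)

/-- For `m ≠ n`, as `h → 0⁺`, `A_{mn}(h)/h` tends to the first-order Maclaurin coefficient
`A^{(1)}_{mn} = ((−1)^{m+n} − 1)(m + n + 2s)/(2π²(m−n)³)`. -/
theorem statement17 (m n : ℤ) (hmn : m ≠ n) (s : ℝ) (hs0 : 0 ≤ s) (hs1 : s < 1) :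
    Filter.Tendsto (fun h : ℝ => diracBogoA s m n h / h) (nhdsWithin 0 (Set.Ioi 0))
      (nhds ((((-1 : ℝ) ^ (m + n) - 1) * ((m : ℝ) + (n : ℝ) + 2 * s)) /
        (2 * Real.pi ^ 2 * ((m : ℝ) - (n : ℝ)) ^ 3))) := by
  have hsmall : ∀ᶠ h : ℝ in nhdsWithin 0 (Set.Ioi 0), h ∈ Set.Ioc (0 : ℝ) (1 / 2) :=
    Ioc_mem_nhdsGT (by norm_num)
  rw [tendsto_iff_norm_sub_tendsto_zero]
  have hlim : Filter.Tendsto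
      (fun h : ℝ => (3 + 8 * ((m + s) * Real.pi) ^ 2 + 3 * |(m + s) * Real.pi|) * h)
      (nhdsWithin 0 (Set.Ioi 0)) (nhds 0) :=
    tendsto_nhdsWithin_of_tendsto_nhds
      ((continuous_const.mul continuous_id).tendsto' 0 0 (mul_zero _))
  refine squeeze_zero' (Filter.Eventually.of_forall fun _ => norm_nonneg _) ?_ hlim
  filter_upwards [hsmall] with h hh
  have h0 : 0 < h := hh.1
  have key := abs_diracBogoA_sub_le m n hmn s h0 hh.2
  rw [Real.norm_eq_abs, div_sub' h0.ne', abs_div, abs_of_pos h0, div_le_iff₀ h0]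
  exact key.trans_eq (by ring)
end
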